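/- Let (X₁, X₂) be standard max-stable with generator (Z₁, Z₂) and D-norm ‖·‖_D. Then the mean squared error E[(X₁ − X₂)²] satisfies E[(X₁ − X₂)²] = 2(2 − ∫₀^∞ ‖(1,u)‖_D^{-2} du). -/

import Mathlib

open MeasureTheory ProbabilityTheory

/-- Layer cake formula for the mixed second moment of two nonnegative functions. -/
theorem lintegral_ofReal_mul_eq_lintegral_lintegral_meas_le {α : Type*} [MeasurableSpace α]
    (μ : Measure α) [SFinite μ] {f g : α → ℝ} (hf : Measurable f) (hg : Measurable g)
    (hf0 : ∀ᵐ a ∂μ, 0 ≤ f a) (hg0 : ∀ᵐ a ∂μ, 0 ≤ g a) :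
    ∫⁻ a, ENNReal.ofReal (f a * g a) ∂μ
      = ∫⁻ x in Set.Ioi (0 : ℝ), ∫⁻ y in Set.Ioi (0 : ℝ), μ {a | x ≤ f a ∧ y ≤ g a} := by
  have hprod : ∫⁻ a, ENNReal.ofReal (f a * g a) ∂μ
      = ∫⁻ a, ENNReal.ofReal (f a) ∂(μ.withDensity fun a => ENNReal.ofReal (g a)) := by
    rw [lintegral_withDensity_eq_lintegral_mul _ hg.ennreal_ofReal hf.ennreal_ofReal]
    refine lintegral_congr_ae ?_
    filter_upwards [hf0] with a ha
    rw [ENNReal.ofReal_mul ha, Pi.mul_apply, mul_comm]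
  rw [hprod, lintegral_eq_lintegral_meas_le _
    ((withDensity_absolutelyContinuous _ _).ae_le hf0) hf.aemeasurable]
  refine lintegral_congr fun x => ?_
  have hx : MeasurableSet {a | x ≤ f a} := measurableSet_le measurable_const hf
  rw [withDensity_apply _ hx,
    lintegral_eq_lintegral_meas_le _ (ae_restrict_of_ae hg0) hg.aemeasurable]
  refine lintegral_congr fun y => ?_
  rw [Measure.restrict_apply (measurableSet_le measurable_const hg), Set.inter_comm]
  rfl

theorem lintegral_mul_exp_neg_mul_Ioi {r : ℝ} (hr : 0 < r) :
    ∫⁻ t in Set.Ioi (0 : ℝ), ENNReal.ofReal (t * Real.exp (-(t * r)))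
      = ENNReal.ofReal ((r ^ 2)⁻¹) := by
  have h := Real.integral_rpow_mul_exp_neg_mul_Ioi (a := 2) two_pos hr
  have hval : ∫ t in Set.Ioi (0 : ℝ), t * Real.exp (-(t * r)) = (r ^ 2)⁻¹ := by
    convert h using 1
    · refine setIntegral_congr_fun measurableSet_Ioi fun t _ => ?_
      norm_num [mul_comm]
    · norm_num
  rw [← hval, ofReal_integral_eq_lintegral_ofReal]
  · refine Integrable.of_integral_ne_zero ?_
    rw [hval]
    positivity
  · filter_upwards [ae_restrict_mem measurableSet_Ioi] with t ht
    exact mul_nonneg (le_of_lt ht) (Real.exp_pos _).le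

/-- The second moment of a standard exponential variable. -/
theorem lintegral_ofReal_sq_of_meas_le_eq_exp {α : Type*} [MeasurableSpace α]
    (μ : Measure α) {f : α → ℝ} (hf : Measurable f) (hf0 : ∀ᵐ a ∂μ, 0 ≤ f a)
    (htail : ∀ t, 0 < t → μ {a | t ≤ f a} = ENNReal.ofReal (Real.exp (-t))) :
    ∫⁻ a, ENNReal.ofReal (f a ^ 2) ∂μ = ENNReal.ofReal 2 := by
  have h := lintegral_rpow_eq_lintegral_meas_le_mul μ hf0 hf.aemeasurable two_pos
  simp only [Real.rpow_two] at h
  rw [h]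
  have htail' : ∫⁻ t in Set.Ioi (0 : ℝ), μ {a | t ≤ f a} * ENNReal.ofReal (t ^ ((2 : ℝ) - 1))
      = ∫⁻ t in Set.Ioi (0 : ℝ), ENNReal.ofReal (t * Real.exp (-(t * 1))) := by
    refine setLIntegral_congr_fun measurableSet_Ioi fun t ht => ?_
    have ht' : (0 : ℝ) < t := ht
    rw [htail t ht', mul_comm, ← ENNReal.ofReal_mul (by positivity)]
    norm_num
  rw [htail', lintegral_mul_exp_neg_mul_Ioi one_pos]
  norm_num

/-- Integrating `exp (-N)` over the positive quadrant, in the coordinates `(x, x * u)`. -/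
theorem lintegral_lintegral_exp_neg_of_homogeneous {F : ℝ → ℝ → ℝ} {N : ℝ → ℝ}
    (hN : Measurable N) (hN0 : ∀ u, 0 < N u)
    (hF : ∀ x u, 0 < x → F x (x * u) = x * N u) :
    ∫⁻ x in Set.Ioi (0 : ℝ), ∫⁻ y in Set.Ioi (0 : ℝ), ENNReal.ofReal (Real.exp (-F x y))
      = ∫⁻ u in Set.Ioi (0 : ℝ), ENNReal.ofReal ((N u ^ 2)⁻¹) := by
  have hscale : ∀ x ∈ Set.Ioi (0 : ℝ),
      ∫⁻ y in Set.Ioi (0 : ℝ), ENNReal.ofReal (Real.exp (-F x y))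
        = ∫⁻ u in Set.Ioi (0 : ℝ), ENNReal.ofReal (x * Real.exp (-(x * N u))) := by
    intro x hx
    have hx0 : (0 : ℝ) < x := hx
    have himage : (fun u => x * u) '' Set.Ioi (0 : ℝ) = Set.Ioi 0 := by
      rw [Set.image_mul_left_Ioi hx0, mul_zero]
    have h := lintegral_image_eq_lintegral_abs_deriv_mul (s := Set.Ioi (0 : ℝ))
      (f := fun u => x * u) (f' := fun _ => x) measurableSet_Ioi
      (fun u _ => by simpa using ((hasDerivAt_id u).const_mul x).hasDerivWithinAt)
      (mul_right_injective₀ hx0.ne').injOn (fun y => ENNReal.ofReal (Real.exp (-F x y)))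
    rw [himage] at h
    rw [h]
    refine lintegral_congr fun u => ?_
    rw [hF x u hx0, abs_of_pos hx0, ENNReal.ofReal_mul hx0.le]
  rw [setLIntegral_congr_fun measurableSet_Ioi hscale, lintegral_lintegral_swap]
  · exact lintegral_congr fun u => lintegral_mul_exp_neg_mul_Ioi (hN0 u)
  · refine Measurable.aemeasurable (Measurable.ennreal_ofReal ?_)
    fun_prop

section DNorm

variable {α : Type*} [MeasurableSpace α] {μ : Measure α} {Z₁ Z₂ : α → ℝ}

theorem measurable_integral_max_abs_mul (c : ℝ) (h₁ : Integrable Z₁ μ) (h₂ : Integrable Z₂ μ)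
    (h₂pos : ∀ᵐ a ∂μ, 0 ≤ Z₂ a) :
    Measurable fun u : ℝ => ∫ a, max (c * Z₁ a) (|u| * Z₂ a) ∂μ := by
  have hmono : Monotone fun t : ℝ => ∫ a, max (c * Z₁ a) (t * Z₂ a) ∂μ := by
    intro s t hst
    refine integral_mono_ae ((h₁.const_mul c).sup (h₂.const_mul s))
      ((h₁.const_mul c).sup (h₂.const_mul t)) ?_
    filter_upwards [h₂pos] with a ha
    exact max_le_max le_rfl (mul_le_mul_of_nonneg_right hst ha)
  exact hmono.measurable.comp measurable_norm

theorem integral_le_integral_max_abs_mul (h₁ : Integrable Z₁ μ) (h₂ : Integrable Z₂ μ) (u : ℝ) :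
    ∫ a, Z₁ a ∂μ ≤ ∫ a, max (|1| * Z₁ a) (|u| * Z₂ a) ∂μ := by
  refine integral_mono h₁ ((h₁.const_mul _).sup (h₂.const_mul _)) fun a => ?_
  simp

theorem integral_max_abs_mul_smul {x : ℝ} (hx : 0 < x) (u : ℝ) :
    ∫ a, max (|x| * Z₁ a) (|x * u| * Z₂ a) ∂μ
      = x * ∫ a, max (|1| * Z₁ a) (|u| * Z₂ a) ∂μ := by
  rw [← integral_const_mul]
  refine integral_congr_ae (Filter.Eventually.of_forall fun a => ?_)
  simp only
  rw [mul_max_of_nonneg _ _ hx.le, abs_mul, abs_of_pos hx, abs_one, one_mul, mul_assoc]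

end DNorm

/-- Let `(X₁, X₂)` be standard max-stable with generator `(Z₁, Z₂)` and
`D`-norm `‖(x,y)‖_D = E (max (|x| Z₁) (|y| Z₂))`. Then the mean squared error satisfies
`E ((X₁ - X₂)²) = 2 (2 - ∫₀^∞ ‖(1,u)‖_D⁻² du)`. -/
theorem mse_of_standard_max_stable
    {Ω : Type*} [MeasureSpace Ω] [IsProbabilityMeasure (ℙ : Measure Ω)]
    (Z₁ Z₂ X₁ X₂ : Ω → ℝ)
    (hZ₁int : Integrable Z₁) (hZ₂int : Integrable Z₂)
    (hZ₁pos : ∀ᵐ ω ∂ℙ, 0 ≤ Z₁ ω) (hZ₂pos : ∀ᵐ ω ∂ℙ, 0 ≤ Z₂ ω)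
    (hZ₁one : ∫ ω, Z₁ ω = 1) (hZ₂one : ∫ ω, Z₂ ω = 1)
    (hX₁meas : Measurable X₁) (hX₂meas : Measurable X₂)
    (hX₁neg : ∀ᵐ ω ∂ℙ, X₁ ω ≤ 0) (hX₂neg : ∀ᵐ ω ∂ℙ, X₂ ω ≤ 0)
    (hmaxstable : ∀ x y : ℝ, x ≤ 0 → y ≤ 0 →
      (ℙ {ω | X₁ ω ≤ x ∧ X₂ ω ≤ y}).toReal
        = Real.exp (-(∫ ω, max (|x| * Z₁ ω) (|y| * Z₂ ω)))) :
    ∫ ω, (X₁ ω - X₂ ω) ^ 2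
      = 2 * (2 - ∫ u in Set.Ioi (0 : ℝ), ((∫ ω, max (|1| * Z₁ ω) (|u| * Z₂ ω)) ^ 2)⁻¹) := by
  set N : ℝ → ℝ := fun u => ∫ ω, max (|1| * Z₁ ω) (|u| * Z₂ ω)
  have hNmeas : Measurable N := measurable_integral_max_abs_mul _ hZ₁int hZ₂int hZ₂pos
  have hNone : ∀ u, 1 ≤ N u := fun u =>
    hZ₁one ▸ integral_le_integral_max_abs_mul hZ₁int hZ₂int u
  have hjoint : ∀ x y : ℝ, 0 ≤ x → 0 ≤ y → ℙ {ω | x ≤ -X₁ ω ∧ y ≤ -X₂ ω}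
      = ENNReal.ofReal (Real.exp (-(∫ ω, max (|x| * Z₁ ω) (|y| * Z₂ ω)))) := by
    intro x y hx hy
    have h := hmaxstable (-x) (-y) (by linarith) (by linarith)
    rw [abs_neg, abs_neg] at h
    rw [← h, ENNReal.ofReal_toReal (measure_ne_top _ _)]
    simp only [le_neg]
  have hY₁ : ∀ᵐ ω ∂ℙ, 0 ≤ -X₁ ω := hX₁neg.mono fun ω h => neg_nonneg.2 h
  have hY₂ : ∀ᵐ ω ∂ℙ, 0 ≤ -X₂ ω := hX₂neg.mono fun ω h => neg_nonneg.2 h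
  have htail₁ : ∀ t, 0 < t → ℙ {ω | t ≤ -X₁ ω} = ENNReal.ofReal (Real.exp (-t)) := by
    intro t ht
    have hset : ℙ {ω | t ≤ -X₁ ω} = ℙ {ω | t ≤ -X₁ ω ∧ 0 ≤ -X₂ ω} := by
      refine measure_congr ?_
      filter_upwards [hY₂] with ω hω
      exact propext ⟨fun h => ⟨h, hω⟩, fun h => h.1⟩
    have hint : ∫ ω, max (|t| * Z₁ ω) (|0| * Z₂ ω) = t := by
      trans ∫ ω, t * Z₁ ω
      · refine integral_congr_ae ?_
        filter_upwards [hZ₁pos] with ω hω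
        rw [abs_of_pos ht, abs_zero, zero_mul, max_eq_left (mul_nonneg ht.le hω)]
      · rw [integral_const_mul, hZ₁one, mul_one]
    rw [hset, hjoint t 0 ht.le le_rfl, hint]
  have htail₂ : ∀ t, 0 < t → ℙ {ω | t ≤ -X₂ ω} = ENNReal.ofReal (Real.exp (-t)) := by
    intro t ht
    have hset : ℙ {ω | t ≤ -X₂ ω} = ℙ {ω | 0 ≤ -X₁ ω ∧ t ≤ -X₂ ω} := by
      refine measure_congr ?_
      filter_upwards [hY₁] with ω hω
      exact propext ⟨fun h => ⟨hω, h⟩, fun h => h.2⟩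
    have hint : ∫ ω, max (|0| * Z₁ ω) (|t| * Z₂ ω) = t := by
      trans ∫ ω, t * Z₂ ω
      · refine integral_congr_ae ?_
        filter_upwards [hZ₂pos] with ω hω
        rw [abs_of_pos ht, abs_zero, zero_mul, max_eq_right (mul_nonneg ht.le hω)]
      · rw [integral_const_mul, hZ₂one, mul_one]
    rw [hset, hjoint 0 t le_rfl ht.le, hint]
  have hsq₁ := lintegral_ofReal_sq_of_meas_le_eq_exp ℙ hX₁meas.neg hY₁ htail₁
  have hsq₂ := lintegral_ofReal_sq_of_meas_le_eq_exp ℙ hX₂meas.neg hY₂ htail₂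
  simp only [Pi.neg_apply, neg_sq] at hsq₁ hsq₂
  have hmixed : ∫⁻ ω, ENNReal.ofReal (X₁ ω * X₂ ω)
      = ∫⁻ u in Set.Ioi (0 : ℝ), ENNReal.ofReal ((N u ^ 2)⁻¹) := by
    have h := lintegral_ofReal_mul_eq_lintegral_lintegral_meas_le ℙ
      hX₁meas.neg hX₂meas.neg hY₁ hY₂
    simp only [Pi.neg_apply, neg_mul_neg] at h
    rw [h, ← lintegral_lintegral_exp_neg_of_homogeneous
      (F := fun x y => ∫ ω, max (|x| * Z₁ ω) (|y| * Z₂ ω)) hNmeas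
      (fun u => one_pos.trans_le (hNone u)) fun x u hx => integral_max_abs_mul_smul hx u]
    exact setLIntegral_congr_fun measurableSet_Ioi fun x hx =>
      setLIntegral_congr_fun measurableSet_Ioi fun y hy =>
        hjoint x y (le_of_lt hx) (le_of_lt hy)
  have hmoment : ∀ X : Ω → ℝ, Measurable X →
      ∫⁻ ω, ENNReal.ofReal (X ω ^ 2) = ENNReal.ofReal 2 →
      Integrable (fun ω => X ω ^ 2) ∧ ∫ ω, X ω ^ 2 = 2 := by
    intro X hX h
    have h0 : ∀ᵐ ω ∂ℙ, 0 ≤ X ω ^ 2 := Filter.Eventually.of_forall fun ω => sq_nonneg _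
    have hval : ∫ ω, X ω ^ 2 = 2 := by
      rw [integral_eq_lintegral_of_nonneg_ae h0 (hX.pow_const 2).aestronglyMeasurable, h,
        ENNReal.toReal_ofReal two_pos.le]
    exact ⟨Integrable.of_integral_ne_zero (by rw [hval]; exact two_ne_zero), hval⟩
  obtain ⟨hint₁, hval₁⟩ := hmoment X₁ hX₁meas hsq₁
  obtain ⟨hint₂, hval₂⟩ := hmoment X₂ hX₂meas hsq₂
  have hint₁₂ : Integrable fun ω => X₁ ω * X₂ ω :=
    ((memLp_two_iff_integrable_sq hX₁meas.aestronglyMeasurable).2 hint₁).integrable_mul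
      ((memLp_two_iff_integrable_sq hX₂meas.aestronglyMeasurable).2 hint₂)
  have hval₁₂ : ∫ ω, X₁ ω * X₂ ω = ∫ u in Set.Ioi (0 : ℝ), (N u ^ 2)⁻¹ := by
    rw [integral_eq_lintegral_of_nonneg_ae _ hint₁₂.aestronglyMeasurable, hmixed,
      integral_eq_lintegral_of_nonneg_ae]
    · exact Filter.Eventually.of_forall fun u => inv_nonneg.2 (sq_nonneg _)
    · exact (hNmeas.pow_const 2).inv.aestronglyMeasurable
    · filter_upwards [hX₁neg, hX₂neg] with ω h₁ h₂
      exact mul_nonneg_of_nonpos_of_nonpos h₁ h₂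
  have hexpand : ∀ ω, (X₁ ω - X₂ ω) ^ 2 = X₁ ω ^ 2 + X₂ ω ^ 2 - 2 * (X₁ ω * X₂ ω) :=
    fun ω => by ring
  have hint_add : Integrable fun ω => X₁ ω ^ 2 + X₂ ω ^ 2 := hint₁.add hint₂
  simp only [hexpand]
  rw [integral_sub hint_add (hint₁₂.const_mul 2), integral_add hint₁ hint₂,
    integral_const_mul, hval₁, hval₂, hval₁₂]
  ring
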